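/- Let ρ : Matrix ι ι ℂ be positive semidefinite with trace 1 and parity-preserving (S * ρ * S = ρ). Then there exists a vector w : ι × ι → ℂ with (S ⊗ S).mulVec w = w (where S ⊗ S is the Kronecker product of the parity matrix with itself) such that ρ x x' = ∑ y, w (x, y) * conj (w (x', y)) for all x x' : ι; in particular w is a unit vector and ρ is the partial trace over the second factor of the rank-one projection onto w. -/

import Mathlib

open scoped Matrix Kronecker ComplexConjugate ComplexOrder

/-- The parity matrix on `α ⊕ β`: diagonal with `+1` on `α` and `-1` on `β`. -/
noncomputable def parityMatrix (α β : Type*) [DecidableEq α] [DecidableEq β] :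
    Matrix (α ⊕ β) (α ⊕ β) ℂ :=
  Matrix.diagonal (Sum.elim (fun _ => (1 : ℂ)) (fun _ => (-1 : ℂ)))

open scoped MatrixOrder in
/-- A matrix commuting with a positive semidefinite matrix `ρ` commutes with some Hermitian
square root of `ρ`. -/
theorem Matrix.PosSemidef.exists_isHermitian_mul_self_eq_commute
    {n : Type*} [Fintype n] [DecidableEq n]
    {ρ S : Matrix n n ℂ} (hρ : ρ.PosSemidef) (h : Commute ρ S) :
    ∃ A : Matrix n n ℂ, A.IsHermitian ∧ A * A = ρ ∧ Commute A S := by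
  refine ⟨CFC.sqrt ρ, (Matrix.nonneg_iff_posSemidef.mp (CFC.sqrt_nonneg ρ)).isHermitian,
    CFC.sqrt_mul_sqrt_self ρ hρ.nonneg, ?_⟩
  rw [CFC.sqrt_eq_real_sqrt ρ hρ.nonneg, cfcₙ_eq_cfc]
  exact h.cfc_real _

theorem parityMatrix_mul_self (α β : Type*) [Fintype α] [Fintype β] [DecidableEq α]
    [DecidableEq β] : parityMatrix α β * parityMatrix α β = 1 := by
  rw [parityMatrix, Matrix.diagonal_mul_diagonal, ← Matrix.diagonal_one]
  congr 1
  ext (_ | _) <;> simp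

theorem parityMatrix_transpose (α β : Type*) [DecidableEq α] [DecidableEq β] :
    (parityMatrix α β)ᵀ = parityMatrix α β :=
  Matrix.diagonal_transpose _

/-- Purification: every parity-preserving density matrix is the partial trace (over a copy of
the system) of a rank-one projection onto a parity-even unit vector. -/
theorem parity_purification
    {α β : Type*} [Fintype α] [Fintype β] [DecidableEq α] [DecidableEq β]
    (ρ : Matrix (α ⊕ β) (α ⊕ β) ℂ)
    (hpsd : ρ.PosSemidef) (htr : ρ.trace = 1)
    (hpar : parityMatrix α β * ρ * parityMatrix α β = ρ) :
    ∃ w : ((α ⊕ β) × (α ⊕ β)) → ℂ,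
      (parityMatrix α β ⊗ₖ parityMatrix α β).mulVec w = w ∧
      (∀ x x', ρ x x' = ∑ y, w (x, y) * conj (w (x', y))) ∧
      ∑ z, ‖w z‖ ^ 2 = 1 := by
  have hS := parityMatrix_mul_self α β
  have hcomm : Commute ρ (parityMatrix α β) := by
    rw [commute_iff_eq]
    nth_rw 1 [← hpar]
    rw [mul_assoc, hS, mul_one]
  obtain ⟨A, hA, hAA, hAS⟩ := hpsd.exists_isHermitian_mul_self_eq_commute hcomm
  have hρ : ∀ x x', ρ x x' = ∑ y, A x y * conj (A x' y) := fun x x' => by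
    rw [← hAA, Matrix.mul_apply]
    exact Finset.sum_congr rfl fun y _ => by rw [← hA.apply y x']; rfl
  refine ⟨fun z => A z.1 z.2, ?_, hρ, ?_⟩
  · have hvec : (fun z : (α ⊕ β) × (α ⊕ β) => A z.1 z.2) = Matrix.vec Aᵀ := rfl
    rw [hvec, Matrix.kronecker_mulVec_vec, ← parityMatrix_transpose, ← Matrix.transpose_mul,
      ← Matrix.transpose_mul, parityMatrix_transpose, ← mul_assoc, ← hAS.eq, mul_assoc, hS,
      mul_one]
  · have h : (∑ z : (α ⊕ β) × (α ⊕ β), (‖A z.1 z.2‖ : ℂ) ^ 2) = 1 := by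
      rw [← htr, Matrix.trace, Fintype.sum_prod_type]
      simp only [Matrix.diag_apply, hρ, Complex.mul_conj']
    exact_mod_cast h
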